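/- arXiv:1904.01043 — 4 statements merged into one kernel-verified Lean document; each statement's English description precedes it below -/
import Mathlib

section
/- Let K ≥ 4 be an even integer and n ≥ max{20, 2K+1}. For every rung edge e = {(0,y),(1,y)} of ℍ_n (y even), the number of t ∈ {0,…,n−1} with e ∈ ℰ_{A+2t} equals 3, the number of t ∈ {0,…,n−1} with e ∈ ℰ_{B+2t} equals 4, and e ∉ ℰ_{C+s} and e ∉ ℰ_{C̃+s} for every s ∈ {0,…,2n−1}. -/
noncomputable section

/-- The vertex set of the hexagonal chain `ℍ_n`: `V_n = {0,1} × ℤ/2nℤ`. -/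
abbrev Vtx (n : ℕ) := Fin 2 × ZMod (2 * n)

/-- The vertical edges `{(i,y),(i,y+1)}` of `ℍ_n` (oriented as `((i,y),(i,y+1))`). -/
def vertEdges (n : ℕ) [NeZero n] : Finset (Vtx n × Vtx n) :=
  Finset.univ.image fun p : Fin 2 × ZMod (2 * n) => ((p.1, p.2), (p.1, p.2 + 1))

/-- The rung edges `{(0,y),(1,y)}` of `ℍ_n`, for even `y ∈ ℤ/2nℤ`. -/
def rungEdges (n : ℕ) [NeZero n] : Finset (Vtx n × Vtx n) :=
  (Finset.univ.filter fun y : ZMod (2 * n) => Even y.val).image fun y => ((0, y), (1, y))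

/-- The edge set `ℰ_{ℍ_n}` of the hexagonal chain `ℍ_n`. -/
def edges (n : ℕ) [NeZero n] : Finset (Vtx n × Vtx n) := vertEdges n ∪ rungEdges n

/-- `{y ∈ ℤ/2nℤ : a ≤ y ≤ b}` (the image in `ℤ/2nℤ` of the naturals `a ≤ m ≤ b`). -/
def ySet (n : ℕ) [NeZero n] (a b : ℕ) : Finset (ZMod (2 * n)) :=
  (Finset.Icc a b).image (Nat.cast)

/-- The `A`-subsystem `{(i,y) : i ∈ {0,1}, 1 ≤ y ≤ 7} ⊆ V_n`. -/
def subA (n : ℕ) [NeZero n] : Finset (Vtx n) := Finset.univ ×ˢ ySet n 1 7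

/-- The `B`-subsystem `{(i,y) : i ∈ {0,1}, 0 ≤ y ≤ 6} ⊆ V_n`. -/
def subB (n : ℕ) [NeZero n] : Finset (Vtx n) := Finset.univ ×ˢ ySet n 0 6

/-- The `C`-subsystem `{(0,y) : 1 ≤ y ≤ K} ⊆ V_n`. -/
def subC (n : ℕ) [NeZero n] (K : ℕ) : Finset (Vtx n) := {(0 : Fin 2)} ×ˢ ySet n 1 K

/-- The reflected subsystem `C̃ = {(1,y) : 1 ≤ y ≤ K} ⊆ V_n`. -/
def subCt (n : ℕ) [NeZero n] (K : ℕ) : Finset (Vtx n) := {(1 : Fin 2)} ×ˢ ySet n 1 K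

/-- The subsystem `# + s = {(i, y+s) : (i,y) ∈ #}`, i.e. `#` shifted upwards by `s` units. -/
def shiftS {n : ℕ} [NeZero n] (S : Finset (Vtx n)) (s : ℕ) : Finset (Vtx n) :=
  S.image fun p => (p.1, p.2 + (s : ZMod (2 * n)))

/-- `ℰ_S`: the set of edges of `ℍ_n` with both endpoints in `S`. -/
def subEdges {n : ℕ} [NeZero n] (S : Finset (Vtx n)) : Finset (Vtx n × Vtx n) :=
  (edges n).filter fun e => e.1 ∈ S ∧ e.2 ∈ S

theorem mem_ySet {n : ℕ} [NeZero n] {a b : ℕ} {x : ZMod (2 * n)} :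
    x ∈ ySet n a b ↔ ∃ j, (a ≤ j ∧ j ≤ b) ∧ (j : ZMod (2 * n)) = x := by
  simp [ySet]

theorem mem_shiftS {n : ℕ} [NeZero n] {S : Finset (Vtx n)} {s : ℕ} {p : Vtx n} :
    p ∈ shiftS S s ↔ (p.1, p.2 - (s : ZMod (2 * n))) ∈ S := by
  simp only [shiftS, Finset.mem_image]
  constructor
  · rintro ⟨q, hq, rfl⟩
    simpa using hq
  · intro h
    exact ⟨_, h, by simp⟩

theorem rung_mem_edges {n : ℕ} [NeZero n] {y : ZMod (2 * n)} (hy : Even y.val) :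
    (((0, y), (1, y)) : Vtx n × Vtx n) ∈ edges n :=
  Finset.mem_union_right _ <|
    Finset.mem_image_of_mem (fun y : ZMod (2 * n) => (((0, y), (1, y)) : Vtx n × Vtx n)) <|
      Finset.mem_filter.2 ⟨Finset.mem_univ y, hy⟩

/-- A rung lies in the shift of a two-column strip exactly when its height does. -/
theorem rung_mem_subEdges_strip {n : ℕ} [NeZero n] {a b s : ℕ} {y : ZMod (2 * n)}
    (hy : Even y.val) :
    ((0, y), (1, y)) ∈ subEdges (shiftS (Finset.univ ×ˢ ySet n a b) s) ↔
      y - (s : ZMod (2 * n)) ∈ ySet n a b := by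
  simp [subEdges, rung_mem_edges hy, mem_shiftS]

/-- A rung lies in no shift of a set contained in a single column. -/
theorem rung_notMem_subEdges_column {n : ℕ} [NeZero n] {Y : Finset (ZMod (2 * n))} {s : ℕ}
    {i : Fin 2} {y : ZMod (2 * n)} :
    ((0, y), (1, y)) ∉ subEdges (shiftS ({i} ×ˢ Y) s) := by
  intro h
  simp only [subEdges, Finset.mem_filter, mem_shiftS, Finset.mem_product,
    Finset.mem_singleton] at h
  exact zero_ne_one (h.2.1.1.trans h.2.2.1.symm)

theorem sub_two_mul_mem_ySet_iff {n : ℕ} [NeZero n] {a b m t : ℕ} (hb : b < 2 * n)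
    (hm : m < n) (ht : t < n) :
    ((2 * m : ℕ) : ZMod (2 * n)) - ((2 * t : ℕ) : ZMod (2 * n)) ∈ ySet n a b ↔
      ∃ i, (a ≤ 2 * i ∧ 2 * i ≤ b) ∧ (i + t = m ∨ i + t = m + n) := by
  simp only [mem_ySet, eq_sub_iff_add_eq, ← Nat.cast_add, ZMod.natCast_eq_natCast_iff]
  constructor
  · rintro ⟨j, hj, h⟩
    obtain ⟨k, hk⟩ := h.symm.dvd
    push_cast at hk
    have hk₀ : -1 < k := by nlinarith
    have hk₂ : k < 2 := by nlinarith
    obtain rfl | rfl : k = 0 ∨ k = 1 := by omega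
    · exact ⟨j / 2, by omega, by omega⟩
    · exact ⟨j / 2, by omega, by omega⟩
  · rintro ⟨i, hi, h | h⟩
    · exact ⟨2 * i, hi, by rw [← mul_add, h]⟩
    · exact ⟨2 * i, hi, by rw [← mul_add, h, mul_add]; simp [Nat.ModEq]⟩

/-- The number of even shifts of the strip `[a, b]` containing the height `y` of a rung is the
number of even integers in `[a, b]`. -/
theorem card_filter_sub_two_mul_mem_ySet {n : ℕ} [NeZero n] {a b c d : ℕ} (hd : d < n)
    (hb : b < 2 * n) (h : ∀ i, (a ≤ 2 * i ∧ 2 * i ≤ b) ↔ (c ≤ i ∧ i ≤ d))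
    {y : ZMod (2 * n)} (hy : Even y.val) :
    ((Finset.range n).filter
      (fun t => y - ((2 * t : ℕ) : ZMod (2 * n)) ∈ ySet n a b)).card = d + 1 - c := by
  obtain ⟨m, hm⟩ := even_iff_exists_two_mul.1 hy
  have hmn : m < n := by have := y.val_lt; omega
  have hy' : y = ((2 * m : ℕ) : ZMod (2 * n)) := by rw [← hm, ZMod.natCast_zmod_val]
  let f : ℕ → ℕ := fun t => if t ≤ m then m - t else m + n - t
  rw [← Nat.card_Icc]
  apply Finset.card_nbij' f f
  · intro t ht
    simp only [Finset.coe_filter, Finset.mem_range, Set.mem_ofPred_eq] at ht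
    rw [hy', sub_two_mul_mem_ySet_iff hb hmn ht.1] at ht
    obtain ⟨ht, i, hi, hit⟩ := ht
    rw [h] at hi
    have : f t = i := by grind
    simpa [this] using hi
  · intro i hi
    simp only [Finset.coe_Icc, Set.mem_Icc] at hi
    have hf : f i < n := by grind
    simp only [Finset.coe_filter, Finset.mem_range, Set.mem_ofPred_eq]
    rw [hy', sub_two_mul_mem_ySet_iff hb hmn hf]
    exact ⟨hf, i, (h i).2 hi, by grind⟩
  · intro t ht
    simp only [Finset.coe_filter, Finset.mem_range, Set.mem_ofPred_eq] at ht
    grind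
  · intro i hi
    simp only [Finset.coe_Icc, Set.mem_Icc] at hi
    grind

/-- Let `K ≥ 4` be even and `n ≥ max{20, 2K+1}`. Every rung edge `e = {(0,y),(1,y)}`
(`y` even) of `ℍ_n` belongs to `ℰ_{A+2t}` for exactly `3` values of `t ∈ {0,…,n−1}`,
to `ℰ_{B+2t}` for exactly `4` values of `t ∈ {0,…,n−1}`, and to no `ℰ_{C+s}` or
`ℰ_{C̃+s}` with `s ∈ {0,…,2n−1}`. -/
theorem rung_edge_count (K n : ℕ) [NeZero n]
    (hK4 : 4 ≤ K) (hKeven : Even K) (hn : max 20 (2 * K + 1) ≤ n)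
    (y : ZMod (2 * n)) (hy : Even y.val) :
    ((Finset.range n).filter
        (fun t => ((0, y), (1, y)) ∈ subEdges (shiftS (subA n) (2 * t)))).card = 3 ∧
    ((Finset.range n).filter
        (fun t => ((0, y), (1, y)) ∈ subEdges (shiftS (subB n) (2 * t)))).card = 4 ∧
    (∀ s ∈ Finset.range (2 * n),
      ((0, y), (1, y)) ∉ subEdges (shiftS (subC n K) s) ∧
      ((0, y), (1, y)) ∉ subEdges (shiftS (subCt n K) s)) := by
  have hn20 : 20 ≤ n := (le_max_left _ _).trans hn
  refine ⟨?_, ?_, fun s _ => ⟨rung_notMem_subEdges_column, rung_notMem_subEdges_column⟩⟩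
  · simp only [subA, rung_mem_subEdges_strip hy]
    exact card_filter_sub_two_mul_mem_ySet (c := 1) (d := 3) (by omega) (by omega)
      (fun i => by omega) hy
  · simp only [subB, rung_mem_subEdges_strip hy]
    exact card_filter_sub_two_mul_mem_ySet (c := 0) (d := 3) (by omega) (by omega)
      (fun i => by omega) hy
end
end

section
/- Let K ≥ 4 be an even integer and n ≥ max{20, 2K+1}. For every pair of distinct vertical edges e = {(i,y−1),(i,y)} and e' = {(i,y),(i,y+1)} on the same column of ℍ_n, the number of t ∈ {0,…,n−1} with both e,e' ∈ ℰ_{A+2t} plus the number of t ∈ {0,…,n−1} with both e,e' ∈ ℰ_{B+2t} equals 5, and the number of s ∈ {0,…,2n−1} with both e,e' ∈ ℰ_{C+s} or both e,e' ∈ ℰ_{C̃+s} equals K−2. -/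
noncomputable section

theorem mem_ySet_iff {n a b : ℕ} [NeZero n] (hb : b < 2 * n) (w : ZMod (2 * n)) :
    w ∈ ySet n a b ↔ a ≤ w.val ∧ w.val ≤ b := by
  simp only [ySet, Finset.mem_image, Finset.mem_Icc]
  constructor
  · rintro ⟨m, hm, rfl⟩
    rwa [ZMod.val_cast_of_lt (by omega)]
  · exact fun h => ⟨w.val, h, ZMod.natCast_zmod_val w⟩

theorem mem_shiftS_prod_iff {n : ℕ} [NeZero n] (I : Finset (Fin 2)) (Y : Finset (ZMod (2 * n)))
    (s : ℕ) (i : Fin 2) (z : ZMod (2 * n)) :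
    (i, z) ∈ shiftS (I ×ˢ Y) s ↔ i ∈ I ∧ z - s ∈ Y := by
  simp only [shiftS, Finset.mem_image, Finset.mem_product, Prod.mk.injEq]
  constructor
  · rintro ⟨p, ⟨hI, hY⟩, rfl, rfl⟩
    simpa using ⟨hI, hY⟩
  · exact fun h => ⟨(i, z - s), h, rfl, sub_add_cancel _ _⟩

theorem vertical_mem_edges {n : ℕ} [NeZero n] (i : Fin 2) (z : ZMod (2 * n)) :
    ((i, z), (i, z + 1)) ∈ edges n :=
  Finset.mem_union_left _ (Finset.mem_image_of_mem _ (Finset.mem_univ (i, z)))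

theorem adjacent_mem_ySet_iff {n a b : ℕ} [NeZero n] (hb : b + 2 < 2 * n) (w : ZMod (2 * n)) :
    (w - 1 ∈ ySet n a b ∧ w ∈ ySet n a b ∧ w + 1 ∈ ySet n a b) ↔
      a + 1 ≤ w.val ∧ w.val + 1 ≤ b := by
  constructor
  · rintro ⟨h₀, -, h₂⟩
    rw [mem_ySet_iff (by omega)] at h₀ h₂
    obtain ⟨m, rfl⟩ : ∃ m : ZMod (2 * n), w = m + 1 := ⟨w - 1, by ring⟩
    rw [add_sub_cancel_right] at h₀
    have h₁ : m + 1 = ((m.val + 1 : ℕ) : ZMod (2 * n)) := by simp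
    have h₃ : m + 1 + 1 = ((m.val + 2 : ℕ) : ZMod (2 * n)) := by
      push_cast
      rw [ZMod.natCast_zmod_val]
      ring
    rw [h₃, ZMod.val_cast_of_lt (by omega)] at h₂
    rw [h₁, ZMod.val_cast_of_lt (by omega)]
    omega
  · intro h
    obtain ⟨m, hm⟩ : ∃ m, w.val = m + 1 := ⟨w.val - 1, by omega⟩
    have hw : w = ((m + 1 : ℕ) : ZMod (2 * n)) := by rw [← hm, ZMod.natCast_zmod_val]
    simp only [ySet, Finset.mem_image, Finset.mem_Icc]
    refine ⟨⟨m, by omega, ?_⟩, ⟨m + 1, by omega, hw.symm⟩, ⟨m + 2, by omega, ?_⟩⟩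
    · rw [hw]
      push_cast
      ring
    · rw [hw]
      push_cast
      ring

theorem adjacent_mem_subEdges_iff {n a b : ℕ} [NeZero n] (hb : b + 2 < 2 * n)
    (I : Finset (Fin 2)) (s : ℕ) (i : Fin 2) (y : ZMod (2 * n)) :
    (((i, y - 1), (i, y)) ∈ subEdges (shiftS (I ×ˢ ySet n a b) s) ∧
      ((i, y), (i, y + 1)) ∈ subEdges (shiftS (I ×ˢ ySet n a b) s)) ↔
      i ∈ I ∧ a + 1 ≤ (y - s).val ∧ (y - s).val + 1 ≤ b := by
  have he : ((i, y - 1), (i, y)) ∈ edges n := by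
    have h := vertical_mem_edges i (y - 1)
    rwa [sub_add_cancel] at h
  rw [← adjacent_mem_ySet_iff hb, sub_right_comm y (s : ZMod (2 * n)) 1,
    sub_add_eq_add_sub y (s : ZMod (2 * n)) 1]
  simp only [subEdges, Finset.mem_filter, mem_shiftS_prod_iff, he, vertical_mem_edges i y,
    true_and]
  tauto

theorem val_sub_natCast {n : ℕ} [NeZero n] (y : ZMod (2 * n)) {s : ℕ} (hs : s < 2 * n) :
    (y - s).val = if s ≤ y.val then y.val - s else y.val + 2 * n - s := by
  have hy := ZMod.val_lt y
  split_ifs with h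
  · have : y - s = ((y.val - s : ℕ) : ZMod (2 * n)) := by
      rw [Nat.cast_sub h, ZMod.natCast_zmod_val]
    rw [this, ZMod.val_cast_of_lt (by omega)]
  · have : y - s = ((y.val + 2 * n - s : ℕ) : ZMod (2 * n)) := by
      rw [Nat.cast_sub (by omega), Nat.cast_add, ZMod.natCast_zmod_val, ZMod.natCast_self,
        add_zero]
    rw [this, ZMod.val_cast_of_lt (by omega)]

theorem card_shift_window {n a b : ℕ} [NeZero n] (hb : b < 2 * n) (y : ZMod (2 * n)) :
    ((Finset.range (2 * n)).filter fun s : ℕ => a ≤ (y - s).val ∧ (y - s).val ≤ b).card =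
      b + 1 - a := by
  rw [← Nat.card_Icc]
  refine Finset.card_nbij' (fun s : ℕ => (y - s).val) (fun c : ℕ => (y - c).val) ?_ ?_ ?_ ?_
  · intro s hs
    simp only [Finset.coe_filter, Set.mem_ofPred_eq] at hs
    simpa using hs.2
  · intro c hc
    simp only [Finset.coe_Icc, Set.mem_Icc] at hc
    simp only [Finset.coe_filter, Set.mem_ofPred_eq, Finset.mem_range, ZMod.natCast_zmod_val,
      sub_sub_cancel]
    rw [ZMod.val_cast_of_lt (by omega)]
    exact ⟨ZMod.val_lt _, hc⟩
  · intro s hs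
    simp only [Finset.coe_filter, Set.mem_ofPred_eq, Finset.mem_range] at hs
    simp only [ZMod.natCast_zmod_val, sub_sub_cancel]
    exact ZMod.val_cast_of_lt hs.1
  · intro c hc
    simp only [Finset.coe_Icc, Set.mem_Icc] at hc
    simp only [ZMod.natCast_zmod_val, sub_sub_cancel]
    exact ZMod.val_cast_of_lt (by omega)

theorem card_even_shift_window {n a b : ℕ} [NeZero n] (hb : b < 2 * n) (y : ZMod (2 * n)) :
    ((Finset.range n).filter fun t : ℕ =>
        a ≤ (y - (2 * t : ℕ)).val ∧ (y - (2 * t : ℕ)).val ≤ b).card =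
      ((Finset.Icc a b).filter fun c => c % 2 = y.val % 2).card := by
  have hy := ZMod.val_lt y
  refine Finset.card_nbij' (fun t : ℕ => (y - (2 * t : ℕ)).val)
    (fun c : ℕ => (y - c).val / 2) ?_ ?_ ?_ ?_
  · intro t ht
    simp only [Finset.coe_filter, Set.mem_ofPred_eq, Finset.mem_range] at ht
    simp only [Finset.coe_filter, Set.mem_ofPred_eq, Finset.mem_Icc]
    refine ⟨ht.2, ?_⟩
    rw [val_sub_natCast y (by omega)]
    split_ifs <;> omega
  · intro c hc
    simp only [Finset.coe_filter, Set.mem_ofPred_eq, Finset.mem_Icc] at hc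
    simp only [Finset.coe_filter, Set.mem_ofPred_eq, Finset.mem_range]
    have hlt := ZMod.val_lt (y - (c : ZMod (2 * n)))
    rw [val_sub_natCast y (s := 2 * _) (by omega), val_sub_natCast y (s := c) (by omega)]
    split_ifs <;> omega
  · intro t ht
    simp only [Finset.coe_filter, Set.mem_ofPred_eq, Finset.mem_range] at ht
    simp only [ZMod.natCast_zmod_val, sub_sub_cancel]
    rw [ZMod.val_cast_of_lt (by omega)]
    omega
  · intro c hc
    simp only [Finset.coe_filter, Set.mem_ofPred_eq, Finset.mem_Icc] at hc
    have hlt := ZMod.val_lt (y - (c : ZMod (2 * n)))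
    simp only
    rw [val_sub_natCast y (s := 2 * _) (by omega), val_sub_natCast y (s := c) (by omega)]
    split_ifs <;> omega

/-- Let `K ≥ 4` be even and `n ≥ max{20, 2K+1}`. For every pair of distinct vertical edges
`e = {(i,y−1),(i,y)}` and `e' = {(i,y),(i,y+1)}` on the same column of `ℍ_n`, the number of
`t ∈ {0,…,n−1}` with `e, e' ∈ ℰ_{A+2t}` plus the number of `t ∈ {0,…,n−1}` with
`e, e' ∈ ℰ_{B+2t}` equals `5`, and the number of `s ∈ {0,…,2n−1}` with both
`e, e' ∈ ℰ_{C+s}` or both `e, e' ∈ ℰ_{C̃+s}` equals `K−2`. -/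
theorem adjacent_vertical_pair_count (K n : ℕ) [NeZero n]
    (hK4 : 4 ≤ K) (hKeven : Even K) (hn : max 20 (2 * K + 1) ≤ n)
    (i : Fin 2) (y : ZMod (2 * n)) :
    ((Finset.range n).filter
        (fun t => ((i, y - 1), (i, y)) ∈ subEdges (shiftS (subA n) (2 * t)) ∧
                  ((i, y), (i, y + 1)) ∈ subEdges (shiftS (subA n) (2 * t)))).card
      + ((Finset.range n).filter
          (fun t => ((i, y - 1), (i, y)) ∈ subEdges (shiftS (subB n) (2 * t)) ∧
                    ((i, y), (i, y + 1)) ∈ subEdges (shiftS (subB n) (2 * t)))).card = 5 ∧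
    ((Finset.range (2 * n)).filter
        (fun s => (((i, y - 1), (i, y)) ∈ subEdges (shiftS (subC n K) s) ∧
                    ((i, y), (i, y + 1)) ∈ subEdges (shiftS (subC n K) s)) ∨
                  (((i, y - 1), (i, y)) ∈ subEdges (shiftS (subCt n K) s) ∧
                    ((i, y), (i, y + 1)) ∈ subEdges (shiftS (subCt n K) s)))).card
      = K - 2 := by
  have hn' : 20 ≤ n ∧ 2 * K + 1 ≤ n := by simpa using hn
  constructor
  · have hA : ∀ x : ℕ, (2 ≤ x ∧ x + 1 ≤ 7) ↔ (2 ≤ x ∧ x ≤ 6) := by omega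
    have hB : ∀ x : ℕ, (1 ≤ x ∧ x + 1 ≤ 6) ↔ (1 ≤ x ∧ x ≤ 5) := by omega
    simp only [subA, subB, adjacent_mem_subEdges_iff (show 7 + 2 < 2 * n by omega),
      adjacent_mem_subEdges_iff (show 6 + 2 < 2 * n by omega), Finset.mem_univ, true_and,
      Nat.reduceAdd, zero_add, hA, hB]
    rw [card_even_shift_window (by omega), card_even_shift_window (by omega)]
    rcases Nat.mod_two_eq_zero_or_one y.val with h | h <;> rw [h] <;> rfl
  · have hC : ∀ x : ℕ, (2 ≤ x ∧ x + 1 ≤ K) ↔ (2 ≤ x ∧ x ≤ K - 1) := by omega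
    have hi : i = 0 ∨ i = 1 := by omega
    simp only [subC, subCt, adjacent_mem_subEdges_iff (show K + 2 < 2 * n by omega),
      Finset.mem_singleton, ← or_and_right, hi, true_and, Nat.reduceAdd, hC]
    rw [card_shift_window (by omega)]
    omega
end
end

section
/- Let K ≥ 4 be an even integer and n ≥ max{20, 2K+1}. For every pair consisting of a rung edge e = {(0,y₀),(1,y₀)} (y₀ even) and a vertical edge e' of ℍ_n sharing a vertex with e, the number of t ∈ {0,…,n−1} with both e,e' ∈ ℰ_{A+2t} equals 3, the number of t ∈ {0,…,n−1} with both e,e' ∈ ℰ_{B+2t} equals 3, and there is no s with both e,e' ∈ ℰ_{C+s} or both e,e' ∈ ℰ_{C̃+s}. -/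
noncomputable section

/-- Two (oriented) edges share a vertex. -/
abbrev sharesVtx {n : ℕ} (e e' : Vtx n × Vtx n) : Prop :=
  e.1 = e'.1 ∨ e.1 = e'.2 ∨ e.2 = e'.1 ∨ e.2 = e'.2

theorem vert_mem_edges {n : ℕ} [NeZero n] (i : Fin 2) (y : ZMod (2 * n)) :
    (((i, y), (i, y + 1)) : Vtx n × Vtx n) ∈ edges n :=
  Finset.mem_union_left _ (Finset.mem_image.2 ⟨(i, y), Finset.mem_univ _, rfl⟩)

theorem natCast_inj_of_lt {n k l : ℕ} (hk : k < 2 * n) (hl : l < 2 * n)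
    (h : (k : ZMod (2 * n)) = l) : k = l :=
  Nat.ModEq.eq_of_lt_of_lt ((ZMod.natCast_eq_natCast_iff _ _ _).1 h) hk hl

theorem mem_ySet_s12 {n : ℕ} [NeZero n] {a b : ℕ} (hb : b < 2 * n) {z : ZMod (2 * n)} :
    z ∈ ySet n a b ↔ z.val ∈ Finset.Icc a b := by
  simp only [ySet, Finset.mem_image]
  constructor
  · rintro ⟨k, hk, rfl⟩
    rwa [ZMod.val_cast_of_lt ((Finset.mem_Icc.1 hk).2.trans_lt hb)]
  · intro h
    exact ⟨_, h, by simp⟩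

theorem mem_ySet_and_add_one_mem_ySet {n : ℕ} [NeZero n] {a b : ℕ} (hb : b + 1 < 2 * n)
    {z : ZMod (2 * n)} :
    z ∈ ySet n a b ∧ z + 1 ∈ ySet n a b ↔ z + 1 ∈ ySet n (a + 1) b := by
  simp only [ySet, Finset.mem_image, Finset.mem_Icc]
  constructor
  · rintro ⟨⟨k, hk, rfl⟩, l, hl, h⟩
    have : l = k + 1 := natCast_inj_of_lt (n := n) (by omega) (by omega) (by simpa using h)
    exact ⟨l, by omega, h⟩
  · rintro ⟨l, hl, h⟩
    exact ⟨⟨l - 1, by omega, by rw [Nat.cast_sub (by omega), h]; simp⟩, l, by omega, h⟩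

theorem add_one_mem_ySet_succ {n : ℕ} [NeZero n] {a b : ℕ} {z : ZMod (2 * n)} :
    z + 1 ∈ ySet n (a + 1) (b + 1) ↔ z ∈ ySet n a b := by
  simp only [ySet, Finset.mem_image, Finset.mem_Icc]
  constructor
  · rintro ⟨l, hl, h⟩
    exact ⟨l - 1, by omega, by rw [Nat.cast_sub (by omega), h]; simp⟩
  · rintro ⟨l, hl, rfl⟩
    exact ⟨l + 1, by omega, by simp⟩

theorem even_val_sub {n : ℕ} [NeZero n] {y z : ZMod (2 * n)} (hy : Even y.val)
    (hz : Even z.val) : Even (y - z).val := by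
  have h : (((y - z).val + z.val : ℕ) : ZMod (2 * n)) = (y.val : ℕ) := by simp
  have h2 := Nat.ModEq.of_mul_right n ((ZMod.natCast_eq_natCast_iff _ _ _).1 h)
  unfold Nat.ModEq at h2
  rw [Nat.even_iff] at *
  omega

theorem card_even_shifts {n : ℕ} [NeZero n] {y : ZMod (2 * n)} (hy : Even y.val) {a b : ℕ}
    (hb : b < 2 * n) :
    ((Finset.range n).filter
      fun t => y - ((2 * t : ℕ) : ZMod (2 * n)) ∈ ySet n a b).card =
      ((Finset.Icc a b).filter Even).card := by
  have hval : ∀ k, k < 2 * n → ((k : ℕ) : ZMod (2 * n)).val = k := fun k =>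
    ZMod.val_cast_of_lt
  refine Finset.card_bij (fun t _ => (y - ((2 * t : ℕ) : ZMod (2 * n))).val) ?_ ?_ ?_
  · intro t ht
    rw [Finset.mem_filter, Finset.mem_range, mem_ySet_s12 hb] at ht
    refine Finset.mem_filter.2 ⟨ht.2, even_val_sub hy ?_⟩
    rw [hval _ (by omega)]
    exact even_two_mul t
  · intro t ht t' ht' h
    rw [Finset.mem_filter, Finset.mem_range] at ht ht'
    have := natCast_inj_of_lt (by omega) (by omega)
      (sub_right_injective (ZMod.val_injective _ h))
    omega
  · intro k hk
    obtain ⟨hk, hke⟩ := Finset.mem_filter.1 hk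
    have hkn : k < 2 * n := (Finset.mem_Icc.1 hk).2.trans_lt hb
    have he : Even (y - (k : ZMod (2 * n))).val := even_val_sub hy (by rwa [hval _ hkn])
    have hlt := ZMod.val_lt (y - (k : ZMod (2 * n)))
    have hs : y - ((2 * ((y - (k : ZMod (2 * n))).val / 2) : ℕ) : ZMod (2 * n)) = k := by
      rw [Nat.two_mul_div_two_of_even he]
      simp
    refine ⟨(y - (k : ZMod (2 * n))).val / 2, ?_, ?_⟩
    · rw [Finset.mem_filter, Finset.mem_range, hs, mem_ySet_s12 hb, hval _ hkn]
      exact ⟨by omega, hk⟩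
    · rw [hs, hval _ hkn]

theorem rung_and_vert_mem_subEdges {n : ℕ} [NeZero n] {y₀ y : ZMod (2 * n)}
    (hy₀ : Even y₀.val) (i : Fin 2) (h : y = y₀ ∨ y + 1 = y₀) {a b s : ℕ}
    (hb : b + 1 < 2 * n) :
    (((0, y₀), (1, y₀)) ∈ subEdges (shiftS (Finset.univ ×ˢ ySet n a b) s) ∧
      ((i, y), (i, y + 1)) ∈ subEdges (shiftS (Finset.univ ×ˢ ySet n a b) s)) ↔
    y + 1 - (s : ZMod (2 * n)) ∈ ySet n (a + 1) b := by
  rw [add_sub_right_comm, ← mem_ySet_and_add_one_mem_ySet hb]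
  simp only [subEdges, Finset.mem_filter, mem_shiftS, Finset.mem_product, Finset.mem_univ,
    rung_mem_edges hy₀, vert_mem_edges, true_and, and_self, add_sub_right_comm]
  rcases h with rfl | rfl
  · tauto
  · rw [add_sub_right_comm]
    tauto

theorem card_rung_and_vert_mem_subEdges {n : ℕ} [NeZero n] {y₀ y : ZMod (2 * n)}
    (hy₀ : Even y₀.val) (i : Fin 2) (h : y = y₀ ∨ y + 1 = y₀) {a b : ℕ}
    (hb : b + 2 < 2 * n)
    (hlower : ((Finset.Icc a b).filter Even).card = 3)
    (hupper : ((Finset.Icc (a + 1) (b + 1)).filter Even).card = 3) :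
    ((Finset.range n).filter fun t =>
      ((0, y₀), (1, y₀)) ∈ subEdges (shiftS (Finset.univ ×ˢ ySet n a (b + 1)) (2 * t)) ∧
      ((i, y), (i, y + 1)) ∈
        subEdges (shiftS (Finset.univ ×ˢ ySet n a (b + 1)) (2 * t))).card = 3 := by
  simp only [rung_and_vert_mem_subEdges hy₀ i h hb]
  rcases h with rfl | rfl
  · simp only [add_sub_right_comm, add_one_mem_ySet_succ]
    rw [card_even_shifts hy₀ (by omega), hlower]
  · rw [card_even_shifts hy₀ (by omega), hupper]

theorem rung_notMem_subEdges_singleton {n : ℕ} [NeZero n] (y : ZMod (2 * n)) (j : Fin 2)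
    (T : Finset (ZMod (2 * n))) (s : ℕ) :
    ((0, y), (1, y)) ∉ subEdges (shiftS ({j} ×ˢ T) s) := by
  intro h
  simp only [subEdges, Finset.mem_filter, mem_shiftS, Finset.mem_product,
    Finset.mem_singleton] at h
  exact zero_ne_one (h.2.1.1.trans h.2.2.1.symm)

/-- Let `K ≥ 4` be even and `n ≥ max{20, 2K+1}`. For every rung edge
`e = {(0,y₀),(1,y₀)}` (`y₀` even) and every vertical edge `e'` of `ℍ_n` sharing a vertex
with `e`: the number of `t ∈ {0,…,n−1}` with `e, e' ∈ ℰ_{A+2t}` equals `3`, the number of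
`t ∈ {0,…,n−1}` with `e, e' ∈ ℰ_{B+2t}` equals `3`, and there is no `s` with both
`e, e' ∈ ℰ_{C+s}` or both `e, e' ∈ ℰ_{C̃+s}`. -/
theorem rung_vertical_pair_count (K n : ℕ) [NeZero n]
    (hK4 : 4 ≤ K) (hKeven : Even K) (hn : max 20 (2 * K + 1) ≤ n)
    (y₀ : ZMod (2 * n)) (hy₀ : Even y₀.val) (i : Fin 2) (y : ZMod (2 * n))
    (hshare : sharesVtx ((0, y₀), (1, y₀)) ((i, y), (i, y + 1))) :
    ((Finset.range n).filter
        (fun t => ((0, y₀), (1, y₀)) ∈ subEdges (shiftS (subA n) (2 * t)) ∧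
                  ((i, y), (i, y + 1)) ∈ subEdges (shiftS (subA n) (2 * t)))).card = 3 ∧
    ((Finset.range n).filter
        (fun t => ((0, y₀), (1, y₀)) ∈ subEdges (shiftS (subB n) (2 * t)) ∧
                  ((i, y), (i, y + 1)) ∈ subEdges (shiftS (subB n) (2 * t)))).card = 3 ∧
    (∀ s ∈ Finset.range (2 * n),
      ¬(((0, y₀), (1, y₀)) ∈ subEdges (shiftS (subC n K) s) ∧
          ((i, y), (i, y + 1)) ∈ subEdges (shiftS (subC n K) s)) ∧
      ¬(((0, y₀), (1, y₀)) ∈ subEdges (shiftS (subCt n K) s) ∧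
          ((i, y), (i, y + 1)) ∈ subEdges (shiftS (subCt n K) s))) := by
  have hn20 : 20 ≤ n := (le_max_left _ _).trans hn
  have h : y = y₀ ∨ y + 1 = y₀ := by
    simp only [sharesVtx, Prod.mk.injEq] at hshare
    grind
  exact ⟨card_rung_and_vert_mem_subEdges hy₀ i h (by omega) (by decide) (by decide),
    card_rung_and_vert_mem_subEdges hy₀ i h (by omega) (by decide) (by decide),
    fun s _ => ⟨fun hs => rung_notMem_subEdges_singleton _ _ _ _ hs.1,
      fun hs => rung_notMem_subEdges_singleton _ _ _ _ hs.1⟩⟩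
end
end

section
/- Let K ≥ 4 be an even integer and n ≥ max{20, 2K+1}. For every unordered pair of distinct edges e, e' of ℍ_n that do not share a vertex, one has (K−2)·[#{t∈{0,…,n−1}: e,e' ∈ ℰ_{A+2t}} + #{t∈{0,…,n−1}: e,e' ∈ ℰ_{B+2t}}] + #{s∈{0,…,2n−1}: e,e' ∈ ℰ_{C+s}} + #{s∈{0,…,2n−1}: e,e' ∈ ℰ_{C̃+s}} ≤ 6(K−2). -/
noncomputable section

open Finset in
/-- A set of even starting points and a set of odd starting points inject jointly into `range (2 * n)`. -/
lemma card_filter_odd_add_card_filter_even_le (n : ℕ) (P Q W : ℕ → Prop)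
    [DecidablePred P] [DecidablePred Q] [DecidablePred W]
    (hP : ∀ t, P t → W (2 * t + 1)) (hQ : ∀ t, Q t → W (2 * t)) :
    #{t ∈ range n | P t} + #{t ∈ range n | Q t} ≤ #{s ∈ range (2 * n) | W s} := by
  have hodd : Function.Injective fun t : ℕ => 2 * t + 1 := fun a b h => by grind
  have heven : Function.Injective fun t : ℕ => 2 * t := fun a b h => by grind
  rw [← card_image_of_injective {t ∈ range n | P t} hodd,
    ← card_image_of_injective {t ∈ range n | Q t} heven, ← card_union_of_disjoint]
  · refine card_le_card fun s hs => ?_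
    simp only [mem_union, mem_image, mem_filter, mem_range] at hs ⊢
    rcases hs with ⟨t, ⟨ht, h⟩, rfl⟩ | ⟨t, ⟨ht, h⟩, rfl⟩
    · exact ⟨by omega, hP t h⟩
    · exact ⟨by omega, hQ t h⟩
  · rw [disjoint_left]
    intro s hs hs'
    simp only [mem_image, mem_filter] at hs hs'
    obtain ⟨t, -, rfl⟩ := hs
    obtain ⟨t', -, h⟩ := hs'
    omega

/-- The starting points `s` of the windows `{s, …, s + L - 1}` in `ℤ/Mℤ` that contain both
`y` and `y'`. -/
def windowStarts {M : ℕ} (L : ℕ) (y y' : ZMod M) : Finset ℕ :=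
  (Finset.range M).filter fun s => (y - s).val < L ∧ (y' - s).val < L

lemma windowStarts_comm {M : ℕ} (L : ℕ) (y y' : ZMod M) :
    windowStarts L y y' = windowStarts L y' y := by
  simp only [windowStarts, and_comm]

lemma card_windowStarts_le_of_val_add_le {M : ℕ} [NeZero M] {L : ℕ} {y y' : ZMod M}
    (hne : y ≠ y') (hL : (y' - y).val + L ≤ M) : (windowStarts L y y').card ≤ L - 1 := by
  have hd : 0 < (y' - y).val := by
    rw [Nat.pos_iff_ne_zero, Ne, ZMod.val_eq_zero, sub_eq_zero]
    exact hne.symm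
  rw [← Finset.card_range (L - 1)]
  refine Finset.card_le_card_of_injOn (fun s => (y - s).val) (fun s hs => ?_) ?_
  · simp only [windowStarts, Finset.coe_filter, Finset.mem_range, Set.mem_ofPred_eq] at hs
    obtain ⟨-, h, h'⟩ := hs
    have hsum : y' - s = (y - s) + (y' - y) := by ring
    rw [hsum, ZMod.val_add_of_lt (by omega)] at h'
    simp only [Finset.coe_range, Set.mem_Iio]
    omega
  · intro s hs t ht h
    simp only [windowStarts, Finset.coe_filter, Finset.mem_range, Set.mem_ofPred_eq] at hs ht
    have h' : (s : ZMod M) = t := sub_right_injective (ZMod.val_injective M h)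
    rw [← ZMod.val_cast_of_lt hs.1, h', ZMod.val_cast_of_lt ht.1]

lemma card_windowStarts_le {M : ℕ} [NeZero M] {L : ℕ} {y y' : ZMod M}
    (hne : y ≠ y') (hL : 2 * L ≤ M) : (windowStarts L y y').card ≤ L - 1 := by
  by_cases h : (y' - y).val + L ≤ M
  · exact card_windowStarts_le_of_val_add_le hne h
  · rw [windowStarts_comm]
    refine card_windowStarts_le_of_val_add_le hne.symm ?_
    have : NeZero (y' - y) := ⟨sub_ne_zero.2 hne.symm⟩
    rw [← neg_sub y' y, ZMod.val_neg_of_ne_zero]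
    omega

lemma val_lt_pred_of_val_add_one_lt {M : ℕ} [NeZero M] {L : ℕ} {x : ZMod M} (hL : L < M)
    (h : x.val < L) (h' : (x + 1).val < L) : x.val < L - 1 := by
  have h1 : (1 : ZMod M).val = 1 := by
    have := ZMod.val_cast_of_lt (n := M) (a := 1) (by omega)
    rwa [Nat.cast_one] at this
  rw [ZMod.val_add_of_lt (by omega), h1] at h'
  omega

section

variable {n : ℕ} [NeZero n]

lemma mem_shiftS_product_ySet {T : Finset (Fin 2)} {a b s : ℕ} {p : Vtx n}
    (h : p ∈ shiftS (T ×ˢ ySet n a b) s) :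
    p.1 ∈ T ∧ (p.2 - a - s).val < b + 1 - a := by
  simp only [shiftS, ySet, Finset.mem_image, Finset.mem_product, Finset.mem_Icc] at h
  obtain ⟨q, ⟨hq, m, ⟨ham, hmb⟩, hm⟩, rfl⟩ := h
  refine ⟨hq, ?_⟩
  have hsub : q.2 + (s : ZMod (2 * n)) - a - s = ((m - a : ℕ) : ZMod (2 * n)) := by
    rw [← hm, Nat.cast_sub ham]
    ring
  simp only [hsub, ZMod.val_natCast]
  exact (Nat.mod_le _ _).trans_lt (by omega)

lemma mem_subEdges_shiftS {T : Finset (Fin 2)} {a b s : ℕ} {e : Vtx n × Vtx n}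
    (h : e ∈ subEdges (shiftS (T ×ˢ ySet n a b) s)) :
    (e.1.1 ∈ T ∧ (e.1.2 - a - s).val < b + 1 - a) ∧
      (e.2.1 ∈ T ∧ (e.2.2 - a - s).val < b + 1 - a) := by
  rw [subEdges, Finset.mem_filter] at h
  exact ⟨mem_shiftS_product_ySet h.2.1, mem_shiftS_product_ySet h.2.2⟩

lemma mem_edges_iff {e : Vtx n × Vtx n} (he : e ∈ edges n) :
    (∃ i y, e = ((i, y), (i, y + 1))) ∨ ∃ y, e = ((0, y), (1, y)) := by
  simp only [edges, vertEdges, rungEdges, Finset.mem_union, Finset.mem_image, Finset.mem_univ,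
    Finset.mem_filter, true_and] at he
  rcases he with ⟨p, rfl⟩ | ⟨y, -, rfl⟩
  · exact Or.inl ⟨p.1, p.2, rfl⟩
  · exact Or.inr ⟨y, rfl⟩

/-- The number of shifts of `A` and `B` containing both `e` and `e'`. -/
abbrev countAB (e e' : Vtx n × Vtx n) : ℕ :=
  ((Finset.range n).filter (fun t => e ∈ subEdges (shiftS (subA n) (2 * t)) ∧
      e' ∈ subEdges (shiftS (subA n) (2 * t)))).card
    + ((Finset.range n).filter (fun t => e ∈ subEdges (shiftS (subB n) (2 * t)) ∧
      e' ∈ subEdges (shiftS (subB n) (2 * t)))).card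

lemma countAB_le_card_windowStarts (e e' : Vtx n × Vtx n) {L : ℕ} {y y' : ZMod (2 * n)}
    (h : ∀ s : ℕ, (e.1.2 - s).val < 7 → (e.2.2 - s).val < 7 → (e'.1.2 - s).val < 7 →
      (e'.2.2 - s).val < 7 → (y - s).val < L ∧ (y' - s).val < L) :
    countAB e e' ≤ (windowStarts L y y').card := by
  refine card_filter_odd_add_card_filter_even_le n _ _ _ (fun t ht => ?_) (fun t ht => ?_)
  · obtain ⟨⟨-, h1⟩, -, h2⟩ := mem_subEdges_shiftS ht.1
    obtain ⟨⟨-, h3⟩, -, h4⟩ := mem_subEdges_shiftS ht.2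
    have hs (z : ZMod (2 * n)) :
        z - ((1 : ℕ) : ZMod (2 * n)) - ((2 * t : ℕ) : ZMod (2 * n)) =
          z - ((2 * t + 1 : ℕ) : ZMod (2 * n)) := by
      push_cast
      ring
    rw [hs] at h1 h2 h3 h4
    exact h _ h1 h2 h3 h4
  · obtain ⟨⟨-, h1⟩, -, h2⟩ := mem_subEdges_shiftS ht.1
    obtain ⟨⟨-, h3⟩, -, h4⟩ := mem_subEdges_shiftS ht.2
    rw [Nat.cast_zero, sub_zero] at h1 h2 h3 h4
    exact h _ h1 h2 h3 h4

/-- The number of shifts of `{i} × {1, …, K}` containing both `e` and `e'`. -/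
abbrev countC (i : Fin 2) (K : ℕ) (e e' : Vtx n × Vtx n) : ℕ :=
  ((Finset.range (2 * n)).filter
    (fun s => e ∈ subEdges (shiftS ({i} ×ˢ ySet n 1 K) s) ∧
      e' ∈ subEdges (shiftS ({i} ×ˢ ySet n 1 K) s))).card

lemma countC_eq_zero {i : Fin 2} {K : ℕ} {e e' : Vtx n × Vtx n}
    (h : ¬ (e.1.1 = i ∧ e.2.1 = i ∧ e'.1.1 = i ∧ e'.2.1 = i)) : countC i K e e' = 0 := by
  rw [countC, Finset.card_eq_zero, Finset.filter_eq_empty_iff]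
  rintro s - ⟨h1, h2⟩
  have h1 := mem_subEdges_shiftS h1
  have h2 := mem_subEdges_shiftS h2
  simp only [Finset.mem_singleton] at h1 h2
  exact h ⟨h1.1.1, h1.2.1, h2.1.1, h2.2.1⟩

lemma countC_vertical_le {K : ℕ} (hK : K < n) (i j j' : Fin 2) {y y' : ZMod (2 * n)}
    (hne : y ≠ y') :
    countC i K ((j, y), (j, y + 1)) ((j', y'), (j', y' + 1)) ≤ K - 2 := by
  refine le_trans (Finset.card_le_card ?_)
    (card_windowStarts_le (L := K - 1) (y := y - 1) (y' := y' - 1)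
      (fun h => hne (sub_left_injective h)) (by omega))
  refine Finset.monotone_filter_right _ fun s _ hs => ?_
  obtain ⟨⟨-, h1⟩, -, h2⟩ := mem_subEdges_shiftS hs.1
  obtain ⟨⟨-, h3⟩, -, h4⟩ := mem_subEdges_shiftS hs.2
  simp only [Nat.cast_one, Nat.add_sub_cancel] at h1 h2 h3 h4
  have hs (z : ZMod (2 * n)) : z + 1 - 1 - s = z - 1 - s + 1 := by ring
  rw [hs] at h2 h4
  exact ⟨val_lt_pred_of_val_add_one_lt (by omega) h1 h2,
    val_lt_pred_of_val_add_one_lt (by omega) h3 h4⟩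

lemma countAB_vertical_le (hn : 7 ≤ n) (i j : Fin 2) {y y' : ZMod (2 * n)} (hne : y ≠ y') :
    countAB ((i, y), (i, y + 1)) ((j, y'), (j, y' + 1)) ≤ 5 := by
  refine (countAB_le_card_windowStarts _ _ fun s h1 h2 h3 h4 => ?_).trans
    (card_windowStarts_le (L := 6) hne (by omega))
  have hs (z : ZMod (2 * n)) : z + 1 - s = z - s + 1 := by ring
  simp only [hs] at h1 h2 h3 h4
  exact ⟨val_lt_pred_of_val_add_one_lt (by omega) h1 h2,
    val_lt_pred_of_val_add_one_lt (by omega) h3 h4⟩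

lemma countAB_le_six (hn : 7 ≤ n) {e e' : Vtx n × Vtx n} (he : e ∈ edges n)
    (he' : e' ∈ edges n) (hne : e ≠ e') : countAB e e' ≤ 6 := by
  have hsucc (y : ZMod (2 * n)) : y ≠ y + 1 := by
    have : Fact (1 < 2 * n) := ⟨by omega⟩
    simp
  rcases mem_edges_iff he with ⟨i, y, rfl⟩ | ⟨y, rfl⟩
  · exact (countAB_le_card_windowStarts _ _ fun s h1 h2 _ _ => ⟨h1, h2⟩).trans
      (card_windowStarts_le (L := 7) (hsucc y) (by omega))
  rcases mem_edges_iff he' with ⟨i, y', rfl⟩ | ⟨y', rfl⟩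
  · exact (countAB_le_card_windowStarts _ _ fun s _ _ h3 h4 => ⟨h3, h4⟩).trans
      (card_windowStarts_le (L := 7) (hsucc y') (by omega))
  · have hyy : y ≠ y' := fun h => hne (by rw [h])
    exact (countAB_le_card_windowStarts _ _ fun s h1 _ h3 _ => ⟨h1, h3⟩).trans
      (card_windowStarts_le (L := 7) hyy (by omega))

/-- Two distinct edges lying on a common vertical side are vertical, at different heights. -/
lemma exists_vertical_of_common_side {i : Fin 2} {e e' : Vtx n × Vtx n} (he : e ∈ edges n)
    (he' : e' ∈ edges n) (hne : e ≠ e')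
    (h : e.1.1 = i ∧ e.2.1 = i ∧ e'.1.1 = i ∧ e'.2.1 = i) :
    ∃ y y', y ≠ y' ∧ e = ((i, y), (i, y + 1)) ∧ e' = ((i, y'), (i, y' + 1)) := by
  obtain ⟨h1, h2, h3, h4⟩ := h
  rcases mem_edges_iff he with ⟨j, y, rfl⟩ | ⟨y, rfl⟩
  · rcases mem_edges_iff he' with ⟨j', y', rfl⟩ | ⟨y', rfl⟩
    · simp only at h1 h3
      subst h1 h3
      exact ⟨y, y', fun h => hne (by rw [h]), rfl, rfl⟩
    · exact absurd (h3.trans h4.symm) zero_ne_one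
  · exact absurd (h1.trans h2.symm) zero_ne_one

end

/-- Let `K ≥ 4` be even and `n ≥ max{20, 2K+1}`. For every pair of distinct edges
`e, e'` of `ℍ_n` that do not share a vertex,
`(K−2)·[#{t : e,e' ∈ ℰ_{A+2t}} + #{t : e,e' ∈ ℰ_{B+2t}}]
  + #{s : e,e' ∈ ℰ_{C+s}} + #{s : e,e' ∈ ℰ_{C̃+s}} ≤ 6(K−2)`. -/
theorem nonadjacent_pair_count_bound (K n : ℕ) [NeZero n]
    (hK4 : 4 ≤ K) (hKeven : Even K) (hn : max 20 (2 * K + 1) ≤ n)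
    (e e' : Vtx n × Vtx n) (he : e ∈ edges n) (he' : e' ∈ edges n)
    (hne : e ≠ e') (hnshare : ¬ sharesVtx e e') :
    (K - 2) * (((Finset.range n).filter
          (fun t => e ∈ subEdges (shiftS (subA n) (2 * t)) ∧
                    e' ∈ subEdges (shiftS (subA n) (2 * t)))).card
        + ((Finset.range n).filter
            (fun t => e ∈ subEdges (shiftS (subB n) (2 * t)) ∧
                      e' ∈ subEdges (shiftS (subB n) (2 * t)))).card)
      + ((Finset.range (2 * n)).filter
          (fun s => e ∈ subEdges (shiftS (subC n K) s) ∧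
                    e' ∈ subEdges (shiftS (subC n K) s))).card
      + ((Finset.range (2 * n)).filter
          (fun s => e ∈ subEdges (shiftS (subCt n K) s) ∧
                    e' ∈ subEdges (shiftS (subCt n K) s))).card
    ≤ 6 * (K - 2) := by
  change (K - 2) * countAB e e' + countC 0 K e e' + countC 1 K e e' ≤ 6 * (K - 2)
  have hn20 : 20 ≤ n := (le_max_left _ _).trans hn
  have hKn : 2 * K + 1 ≤ n := (le_max_right _ _).trans hn
  by_cases hside : ∃ i : Fin 2, e.1.1 = i ∧ e.2.1 = i ∧ e'.1.1 = i ∧ e'.2.1 = i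
  · obtain ⟨i, hi⟩ := hside
    obtain ⟨y, y', hyy, rfl, rfl⟩ := exists_vertical_of_common_side he he' hne hi
    have hAB := Nat.mul_le_mul_left (K - 2) (countAB_vertical_le (by omega) i i hyy)
    have hC := countC_vertical_le (K := K) (by omega) i i i hyy
    have hC' : countC (1 - i) K ((i, y), (i, y + 1)) ((i, y'), (i, y' + 1)) = 0 :=
      countC_eq_zero fun h => by
        have := h.1
        fin_cases i <;> simp at this
    fin_cases i <;> simp only [Fin.zero_eta, Fin.mk_one, sub_zero, sub_self] at * <;> omega
  · have hC (i : Fin 2) : countC i K e e' = 0 := countC_eq_zero fun h => hside ⟨i, h⟩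
    rw [hC, hC, add_zero, add_zero, mul_comm]
    exact Nat.mul_le_mul_right _ (countAB_le_six (by omega) he he' hne)
end
end
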